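/- Let f = G·(T_1 + T_2), where G, T_1, T_2 ∈ F[x_1,…,x_n] are products of linear forms, T_1 and T_2 are homogeneous of equal positive degree, T_1 and T_2 have no common linear factor (gcd(T_1,T_2) = 1), and T_1 + T_2 is not a product of linear forms. Let r = dim span{linear forms ℓ : ℓ divides T_1·T_2}. Then there exist linearly independent linear forms y_1, …, y_r such that each y_j vanishes on some codimension-2 subspace W ∈ S(NonLin(f)) (i.e. y_j belongs to the 2-dimensional space of linear forms vanishing on W), and span{y_1,…,y_r} = span{linear forms ℓ : ℓ divides T_1·T_2}. -/

import Mathlib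

open MvPolynomial

/-- A linear form: a nonzero homogeneous degree-1 polynomial. -/
def IsLinearForm {F : Type*} [Field F] {n : ℕ} (ℓ : MvPolynomial (Fin n) F) : Prop :=
  ℓ ≠ 0 ∧ ℓ.IsHomogeneous 1

/-- A product of linear forms (a nonzero scalar multiple of a product of linear forms). -/
def IsProdLinearForms {F : Type*} [Field F] {n : ℕ} (g : MvPolynomial (Fin n) F) : Prop :=
  ∃ (c : F) (L : Multiset (MvPolynomial (Fin n) F)),
    c ≠ 0 ∧ (∀ p ∈ L, IsLinearForm p) ∧ g = c • L.prod

/-- `g` has no linear factors. -/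
def NoLinearFactor {F : Type*} [Field F] {n : ℕ} (g : MvPolynomial (Fin n) F) : Prop :=
  ∀ ℓ : MvPolynomial (Fin n) F, IsLinearForm ℓ → ¬ ℓ ∣ g

/-- `h` is the non-linear part `NonLin(f)` of `f` (up to scalars): `h` has no linear
factors and `f` is a product of linear forms times `h`. -/
def IsNonLinPart {F : Type*} [Field F] {n : ℕ} (f h : MvPolynomial (Fin n) F) : Prop :=
  NoLinearFactor h ∧ ∃ L : MvPolynomial (Fin n) F, IsProdLinearForms L ∧ f = L * h

/-- `S(g)`: the set of codimension-2 subspaces `V(ℓ₁,ℓ₂)` of `F^n` on which `g`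
vanishes, i.e. `g` belongs to the ideal generated by `ℓ₁, ℓ₂`. -/
def vanishCodim2 {F : Type*} [Field F] {n : ℕ} (g : MvPolynomial (Fin n) F) :
    Set (Set (Fin n → F)) :=
  {W | ∃ ℓ₁ ℓ₂ : MvPolynomial (Fin n) F, IsLinearForm ℓ₁ ∧ IsLinearForm ℓ₂ ∧
    LinearIndependent F ![ℓ₁, ℓ₂] ∧
    W = {a : Fin n → F | eval a ℓ₁ = 0 ∧ eval a ℓ₂ = 0} ∧
    g ∈ Ideal.span {ℓ₁, ℓ₂}}

section LinearForms

variable {F : Type*} [Field F] {n : ℕ}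

theorem IsLinearForm.prime {ℓ : MvPolynomial (Fin n) F} (hℓ : IsLinearForm ℓ) : Prime ℓ := by
  refine (irreducible_of_totalDegree_eq_one (hℓ.2.totalDegree hℓ.1) fun x hx => ?_).prime
  obtain ⟨d, hd⟩ := MvPolynomial.ne_zero_iff.mp hℓ.1
  exact isUnit_iff_ne_zero.mpr fun h0 => hd (zero_dvd_iff.mp (h0 ▸ hx d))

theorem IsProdLinearForms.ne_zero {g : MvPolynomial (Fin n) F} (hg : IsProdLinearForms g) :
    g ≠ 0 := by
  obtain ⟨c, L, hc, hL, rfl⟩ := hg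
  exact smul_ne_zero hc (Multiset.prod_ne_zero fun h0 => (hL 0 h0).1 rfl)

theorem IsProdLinearForms.exists_isHomogeneous {g : MvPolynomial (Fin n) F}
    (hg : IsProdLinearForms g) : ∃ k, g.IsHomogeneous k := by
  obtain ⟨c, L, -, hL, rfl⟩ := hg
  suffices ∃ k, L.prod.IsHomogeneous k by
    obtain ⟨k, hk⟩ := this
    exact ⟨k, smul_eq_C_mul L.prod c ▸ hk.C_mul c⟩
  induction L using Multiset.induction_on with
  | empty => exact ⟨0, by simpa using isHomogeneous_one (Fin n) F⟩
  | cons p L ih =>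
    obtain ⟨k, hk⟩ := ih fun q hq => hL q (Multiset.mem_cons_of_mem hq)
    exact ⟨1 + k, by simpa using (hL p (Multiset.mem_cons_self p L)).2.mul hk⟩

theorem isProdLinearForms_C {c : F} (hc : c ≠ 0) :
    IsProdLinearForms (C c : MvPolynomial (Fin n) F) :=
  ⟨c, 0, hc, by simp, by simp [smul_eq_C_mul]⟩

theorem IsLinearForm.mul_isProdLinearForms {ℓ g : MvPolynomial (Fin n) F} (hℓ : IsLinearForm ℓ)
    (hg : IsProdLinearForms g) : IsProdLinearForms (ℓ * g) := by
  obtain ⟨c, L, hc, hL, rfl⟩ := hg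
  exact ⟨c, ℓ ::ₘ L, hc, by simpa using ⟨hℓ, hL⟩, by simp⟩

theorem IsProdLinearForms.C_mul {g : MvPolynomial (Fin n) F} (hg : IsProdLinearForms g) {c : F}
    (hc : c ≠ 0) : IsProdLinearForms (C c * g) := by
  obtain ⟨d, L, hd, hL, rfl⟩ := hg
  exact ⟨c * d, L, mul_ne_zero hc hd, hL, by rw [← smul_eq_C_mul, smul_smul]⟩

/-- A divisor of a product of linear forms is a product of linear forms. -/
theorem IsProdLinearForms.of_dvd {g p : MvPolynomial (Fin n) F} (hg : IsProdLinearForms g)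
    (hp : p ∣ g) : IsProdLinearForms p := by
  obtain ⟨c, L, hc, hL, rfl⟩ := hg
  replace hp : p ∣ L.prod := by
    rwa [smul_eq_C_mul, ((isUnit_iff_ne_zero.mpr hc).map C).dvd_mul_left] at hp
  clear hc
  induction L using Multiset.induction_on generalizing p with
  | empty =>
    obtain ⟨u, hu, rfl⟩ := isUnit_iff_eq_C_of_isReduced.mp (isUnit_of_dvd_one (by simpa using hp))
    exact isProdLinearForms_C hu.ne_zero
  | cons ℓ L ih =>
    have hℓ := hL ℓ (Multiset.mem_cons_self ℓ L)
    have ih' := fun {q} => @ih q fun q hq => hL q (Multiset.mem_cons_of_mem hq)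
    obtain ⟨q, hq⟩ := hp
    rw [Multiset.prod_cons] at hq
    rcases hℓ.prime.dvd_or_dvd (hq ▸ Dvd.intro _ rfl : ℓ ∣ p * q) with ⟨s, rfl⟩ | ⟨s, rfl⟩
    · exact hℓ.mul_isProdLinearForms
        (ih' ⟨q, mul_left_cancel₀ hℓ.1 (by rw [hq, mul_assoc])⟩)
    · exact ih' ⟨s, mul_left_cancel₀ hℓ.1 (by rw [hq, mul_left_comm])⟩

/-- A product of linear forms is coprime to a polynomial without linear factors. -/
theorem IsProdLinearForms.dvd_of_dvd_mul_right {g h p : MvPolynomial (Fin n) F}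
    (hg : IsProdLinearForms g) (hh : NoLinearFactor h) (hd : g ∣ p * h) : g ∣ p := by
  obtain ⟨c, L, hc, hL, rfl⟩ := hg
  rw [smul_eq_C_mul, ((isUnit_iff_ne_zero.mpr hc).map C).mul_left_dvd] at hd ⊢
  clear hc
  induction L using Multiset.induction_on generalizing p with
  | empty => simp
  | cons ℓ L ih =>
    have hℓ := hL ℓ (Multiset.mem_cons_self ℓ L)
    rw [Multiset.prod_cons] at hd ⊢
    obtain ⟨s, rfl⟩ := (hℓ.prime.dvd_or_dvd (dvd_of_mul_right_dvd hd)).resolve_right (hh ℓ hℓ)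
    rw [mul_assoc] at hd
    exact mul_dvd_mul_left ℓ (ih (fun q hq => hL q (Multiset.mem_cons_of_mem hq))
      ((mul_dvd_mul_iff_left hℓ.1).mp hd))

/-- Eliminating a variable with the help of a linear form `ℓ` gives a graded endomorphism of
the polynomial ring that kills `ℓ` and is the identity modulo `ℓ`. -/
theorem IsLinearForm.exists_elimination {ℓ : MvPolynomial (Fin n) F} (hℓ : IsLinearForm ℓ) :
    ∃ φ : MvPolynomial (Fin n) F →ₐ[F] MvPolynomial (Fin n) F,
      φ ℓ = 0 ∧ (∀ p, ℓ ∣ p - φ p) ∧ ∀ p k, p.IsHomogeneous k → (φ p).IsHomogeneous k := by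
  obtain ⟨c, hc⟩ : ∃ c : Fin n → F, ∑ i, c i • X i = ℓ := by
    have h1 := (mem_homogeneousSubmodule 1 ℓ).mpr hℓ.2
    rwa [homogeneousSubmodule_one_eq_span_X, Submodule.mem_span_range_iff_exists_fun] at h1
  obtain ⟨k, hk⟩ : ∃ k, c k ≠ 0 := by
    by_contra! h0
    exact hℓ.1 (by simp [← hc, h0])
  let e : Fin n → F := Pi.single k (c k)⁻¹
  let φ : MvPolynomial (Fin n) F →ₐ[F] MvPolynomial (Fin n) F := aeval fun i => X i - e i • ℓ
  refine ⟨φ, ?_, fun p => ?_, fun p j hp => ?_⟩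
  · have : φ ℓ = ℓ - (∑ i, c i * e i) • ℓ := by
      have hsum : ∑ i, c i • φ (X i) = φ ℓ := by
        simpa only [map_sum, map_smul] using congrArg φ hc
      rw [← hsum]
      simp only [φ, aeval_X, smul_sub, Finset.sum_sub_distrib, smul_smul,
        Finset.sum_smul, hc]
    rw [this, Finset.sum_eq_single k (by simp +contextual [e]) (by simp)]
    simp [e, hk]
  · rw [← Ideal.mem_span_singleton, ← Ideal.Quotient.eq]
    have : (Ideal.Quotient.mkₐ F (Ideal.span {ℓ})).comp φ = Ideal.Quotient.mkₐ F _ := by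
      refine algHom_ext fun i => ?_
      simp only [AlgHom.comp_apply, φ, aeval_X, Ideal.Quotient.mkₐ_eq_mk]
      rw [Ideal.Quotient.eq, sub_sub_cancel_left, neg_mem_iff]
      exact Submodule.smul_of_tower_mem _ _ (Ideal.mem_span_singleton_self ℓ)
    exact (DFunLike.congr_fun this p).symm
  · rw [← one_mul j]
    exact hp.aeval _ fun i =>
      (isHomogeneous_X F i).sub (smul_eq_C_mul ℓ (e i) ▸ hℓ.2.C_mul (e i))

theorem IsProdLinearForms.map {g : MvPolynomial (Fin n) F} (hg : IsProdLinearForms g)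
    {φ : MvPolynomial (Fin n) F →ₐ[F] MvPolynomial (Fin n) F}
    (hφ : ∀ p, p.IsHomogeneous 1 → (φ p).IsHomogeneous 1) (h0 : φ g ≠ 0) :
    IsProdLinearForms (φ g) := by
  obtain ⟨c, L, hc, hL, rfl⟩ := hg
  refine ⟨c, L.map φ, hc, fun q hq => ?_, by rw [map_smul, map_multiset_prod]⟩
  obtain ⟨p, hp, rfl⟩ := Multiset.mem_map.mp hq
  refine ⟨fun hp0 => h0 ?_, hφ p (hL p hp).2⟩
  rw [map_smul, map_multiset_prod, Multiset.prod_eq_zero (hp0 ▸ Multiset.mem_map_of_mem φ hp),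
    smul_zero]

/-- If `ℓ` divides `T₁` but not `T₂`, then every non-constant cofactor `h` of a product of linear
forms in `T₁ + T₂` without linear factors vanishes on a codimension-2 subspace of `V(ℓ)`. -/
theorem exists_isLinearForm_mem_span_pair {m : ℕ} {T₁ T₂ L h ℓ : MvPolynomial (Fin n) F}
    (hT₂ : IsProdLinearForms T₂) (hT₁hom : T₁.IsHomogeneous m) (hT₂hom : T₂.IsHomogeneous m)
    (hL : IsProdLinearForms L) (hLh : T₁ + T₂ = L * h) (hh : NoLinearFactor h)
    (hdeg : h.totalDegree ≠ 0) (hℓ : IsLinearForm ℓ) (h₁ : ℓ ∣ T₁) (h₂ : ¬ ℓ ∣ T₂) :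
    ∃ p, IsLinearForm p ∧ LinearIndependent F ![ℓ, p] ∧ h ∈ Ideal.span {ℓ, p} := by
  obtain ⟨φ, hφℓ, hφ, hφhom⟩ := hℓ.exists_elimination
  have hφT₂ : φ T₂ ≠ 0 := fun h0 => h₂ (by simpa [h0] using hφ T₂)
  have hφLh : φ T₂ = φ L * φ h := by
    obtain ⟨s, rfl⟩ := h₁
    simpa [hφℓ] using congrArg φ hLh
  obtain ⟨c, M, hc, hM, hφh⟩ :=
    (hT₂.map (fun p => hφhom p 1) hφT₂).of_dvd (Dvd.intro_left _ hφLh.symm)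
  rcases M.empty_or_exists_mem with rfl | ⟨p, hp⟩
  · exfalso
    obtain ⟨k, hk⟩ := hL.exists_isHomogeneous
    have hkm : k = m := by
      refine IsHomogeneous.inj_right ?_ (hφhom _ _ hT₂hom) hφT₂
      rw [hφLh, hφh, Multiset.prod_zero, smul_eq_C_mul, mul_one, mul_comm]
      exact (hφhom _ _ hk).C_mul c
    have hh0 : h ≠ 0 := by
      rintro rfl
      simp at hdeg
    have hle := (hT₁hom.add hT₂hom).totalDegree_le
    rw [hLh, totalDegree_mul_of_isDomain hL.ne_zero hh0, hk.totalDegree hL.ne_zero] at hle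
    omega
  · have hpφ : p ∣ φ h := hφh ▸ dvd_smul_of_dvd c (Multiset.dvd_prod hp)
    refine ⟨p, hM p hp, (LinearIndependent.pair_iff' hℓ.1).mpr fun a ha => hh ℓ hℓ ?_, ?_⟩
    · rw [← sub_add_cancel h (φ h)]
      exact dvd_add (hφ h) ((ha ▸ dvd_smul_of_dvd a dvd_rfl : ℓ ∣ p).trans hpφ)
    · rw [← sub_add_cancel h (φ h)]
      exact add_mem (Ideal.mem_of_dvd _ (hφ h) (Ideal.subset_span (by simp)))
        (Ideal.mem_of_dvd _ hpφ (Ideal.subset_span (by simp)))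

end LinearForms

/-- There are `r` linearly independent linear forms, each lying in the 2-dimensional
space of linear forms vanishing on some `W ∈ S(NonLin(f))`, whose span equals the span
of the linear factors of `T₁·T₂`, where `r` is the dimension of the latter span. -/
theorem exists_basis_from_vanishing_codim2
    {F : Type*} [Field F] [Fintype F] {n m r : ℕ}
    (G T₁ T₂ f h : MvPolynomial (Fin n) F)
    (hm : 0 < m)
    (hG : IsProdLinearForms G) (hT₁ : IsProdLinearForms T₁) (hT₂ : IsProdLinearForms T₂)
    (hT₁hom : T₁.IsHomogeneous m) (hT₂hom : T₂.IsHomogeneous m)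
    (hgcd : ∀ ℓ : MvPolynomial (Fin n) F, IsLinearForm ℓ → ℓ ∣ T₁ → ¬ ℓ ∣ T₂)
    (hnl : ¬ IsProdLinearForms (T₁ + T₂))
    (hf : f = G * (T₁ + T₂)) (hh : IsNonLinPart f h)
    (hr : r = Module.finrank F
      ↥(Submodule.span F {ℓ : MvPolynomial (Fin n) F | IsLinearForm ℓ ∧ ℓ ∣ T₁ * T₂})) :
    ∃ y : Fin r → MvPolynomial (Fin n) F,
      (∀ j, IsLinearForm (y j)) ∧ LinearIndependent F y ∧
      (∀ j, ∃ ℓ₁ ℓ₂ : MvPolynomial (Fin n) F,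
        IsLinearForm ℓ₁ ∧ IsLinearForm ℓ₂ ∧ LinearIndependent F ![ℓ₁, ℓ₂] ∧
        h ∈ Ideal.span {ℓ₁, ℓ₂} ∧
        y j ∈ Submodule.span F ({ℓ₁, ℓ₂} : Set (MvPolynomial (Fin n) F))) ∧
      Submodule.span F (Set.range y) =
        Submodule.span F {ℓ : MvPolynomial (Fin n) F | IsLinearForm ℓ ∧ ℓ ∣ T₁ * T₂} := by
  obtain ⟨hhn, L, hL, hfL⟩ := hh
  obtain ⟨L', rfl⟩ := hG.dvd_of_dvd_mul_right hhn (hfL ▸ hf ▸ Dvd.intro _ rfl)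
  have hLh : T₁ + T₂ = L' * h :=
    mul_left_cancel₀ hG.ne_zero (by rw [← hf, hfL, mul_assoc])
  have hL' := hL.of_dvd (Dvd.intro_left G rfl)
  have := Module.Finite.iff_fg.mpr (homogeneousSubmodule_fg (σ := Fin n) (R := F) 1)
  have : Module.Finite F
      ↥(Submodule.span F {ℓ : MvPolynomial (Fin n) F | IsLinearForm ℓ ∧ ℓ ∣ T₁ * T₂}) :=
    Submodule.finiteDimensional_of_le
      (Submodule.span_le.mpr fun ℓ hℓ => (mem_homogeneousSubmodule 1 ℓ).mpr hℓ.1.2)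
  obtain ⟨y, hyS, hspan, hindep⟩ := Submodule.exists_fun_fin_finrank_span_eq F
    {ℓ : MvPolynomial (Fin n) F | IsLinearForm ℓ ∧ ℓ ∣ T₁ * T₂}
  subst hr
  refine ⟨y, fun j => (hyS j).1, hindep, fun j => ?_, hspan⟩
  obtain ⟨hy, hdvd⟩ := hyS j
  have hdeg : h.totalDegree ≠ 0 := fun h0 => by
    rw [totalDegree_eq_zero_iff_eq_C.mp h0] at hLh hhn
    refine hnl (hLh ▸ mul_comm L' _ ▸ hL'.C_mul fun hc => hhn _ hy ?_)
    simp [hc]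
  obtain ⟨p, hp, hli, hmem⟩ :
      ∃ p, IsLinearForm p ∧ LinearIndependent F ![y j, p] ∧ h ∈ Ideal.span {y j, p} := by
    rcases hy.prime.dvd_or_dvd hdvd with h₁ | h₂
    · exact exists_isLinearForm_mem_span_pair hT₂ hT₁hom hT₂hom hL' hLh hhn hdeg hy h₁
        (hgcd _ hy h₁)
    · exact exists_isLinearForm_mem_span_pair hT₁ hT₂hom hT₁hom hL' (add_comm T₁ T₂ ▸ hLh) hhn
        hdeg hy h₂ fun h₁ => hgcd _ hy h₁ h₂
  exact ⟨y j, p, hy, hp, hli, hmem, Submodule.subset_span (by simp)⟩
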